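/- With P and Q defined recursively from a smooth matrix-valued function A as above, for every k ≥ 1 one has Σ_{r=0}^{k} C(k,r) · (Q (k-r)) * (P r) = 0. -/

import Mathlib

open Matrix Finset

noncomputable def mderiv {n : ℕ} (M : ℝ → Matrix (Fin n) (Fin n) ℝ) :
    ℝ → Matrix (Fin n) (Fin n) ℝ :=
  fun s => Matrix.of fun i j => deriv (fun t => M t i j) s

noncomputable def vderiv {n : ℕ} (Y : ℝ → Fin n → ℝ) : ℝ → Fin n → ℝ :=
  fun s i => deriv (fun t => Y t i) s

def MSmooth {n : ℕ} (M : ℝ → Matrix (Fin n) (Fin n) ℝ) : Prop :=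
  ∀ i j, ContDiff ℝ (⊤ : ℕ∞) (fun s => M s i j)

def VSmooth {n : ℕ} (Y : ℝ → Fin n → ℝ) : Prop :=
  ∀ i, ContDiff ℝ (⊤ : ℕ∞) (fun s => Y s i)

noncomputable def Psym {n : ℕ} (A : ℝ → Matrix (Fin n) (Fin n) ℝ) :
    ℕ → ℝ → Matrix (Fin n) (Fin n) ℝ
  | 0 => fun _ => 1
  | k + 1 => fun s => mderiv (Psym A k) s + A s * Psym A k s

noncomputable def Qsym {n : ℕ} (A : ℝ → Matrix (Fin n) (Fin n) ℝ) :
    ℕ → ℝ → Matrix (Fin n) (Fin n) ℝ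
  | 0 => fun _ => 1
  | k + 1 => fun s => mderiv (Qsym A k) s - Qsym A k s * A s

theorem MSmooth.one {n : ℕ} : MSmooth fun _ => (1 : Matrix (Fin n) (Fin n) ℝ) :=
  fun _ _ => contDiff_const

theorem MSmooth.add {n : ℕ} {M N : ℝ → Matrix (Fin n) (Fin n) ℝ} (hM : MSmooth M)
    (hN : MSmooth N) : MSmooth fun s => M s + N s :=
  fun i j => (hM i j).add (hN i j)

theorem MSmooth.sub {n : ℕ} {M N : ℝ → Matrix (Fin n) (Fin n) ℝ} (hM : MSmooth M)
    (hN : MSmooth N) : MSmooth fun s => M s - N s :=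
  fun i j => (hM i j).sub (hN i j)

theorem MSmooth.mul {n : ℕ} {M N : ℝ → Matrix (Fin n) (Fin n) ℝ} (hM : MSmooth M)
    (hN : MSmooth N) : MSmooth fun s => M s * N s := fun i j => by
  simp only [Matrix.mul_apply]
  exact ContDiff.sum fun l _ => (hM i l).mul (hN l j)

theorem MSmooth.mderiv {n : ℕ} {M : ℝ → Matrix (Fin n) (Fin n) ℝ} (hM : MSmooth M) :
    MSmooth (mderiv M) :=
  fun i j => (contDiff_infty_iff_deriv.1 (hM i j)).2

theorem MSmooth.hasDerivAt {n : ℕ} {M : ℝ → Matrix (Fin n) (Fin n) ℝ} (hM : MSmooth M)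
    (s : ℝ) (i j : Fin n) : HasDerivAt (fun t => M t i j) (_root_.mderiv M s i j) s :=
  ((contDiff_infty_iff_deriv.1 (hM i j)).1 s).hasDerivAt

theorem MSmooth.psym {n : ℕ} {A : ℝ → Matrix (Fin n) (Fin n) ℝ} (hA : MSmooth A) (k : ℕ) :
    MSmooth (Psym A k) := by
  induction k with
  | zero => exact .one
  | succ k ih => exact ih.mderiv.add (hA.mul ih)

theorem MSmooth.qsym {n : ℕ} {A : ℝ → Matrix (Fin n) (Fin n) ℝ} (hA : MSmooth A) (k : ℕ) :
    MSmooth (Qsym A k) := by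
  induction k with
  | zero => exact .one
  | succ k ih => exact ih.mderiv.sub (ih.mul hA)

theorem MSmooth.mderiv_mul {n : ℕ} {M N : ℝ → Matrix (Fin n) (Fin n) ℝ} (hM : MSmooth M)
    (hN : MSmooth N) (s : ℝ) :
    _root_.mderiv (fun t => M t * N t) s =
      _root_.mderiv M s * N s + M s * _root_.mderiv N s := by
  ext i j
  have h := HasDerivAt.fun_sum (u := Finset.univ)
    fun l _ => (hM.hasDerivAt s i l).fun_mul (hN.hasDerivAt s l j)
  simpa only [_root_.mderiv, Matrix.of_apply, Matrix.mul_apply, Matrix.add_apply,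
    Finset.sum_add_distrib] using h.deriv

theorem mderiv_sum_smul {n : ℕ} {ι : Type*} (t : Finset ι) (c : ι → ℕ)
    {M : ι → ℝ → Matrix (Fin n) (Fin n) ℝ} (hM : ∀ r, MSmooth (M r)) (s : ℝ) :
    mderiv (fun u => ∑ r ∈ t, c r • M r u) s = ∑ r ∈ t, c r • mderiv (M r) s := by
  ext i j
  have h := HasDerivAt.fun_sum (u := t)
    fun r _ => ((hM r).hasDerivAt s i j).const_mul (c r : ℝ)
  simpa only [mderiv, Matrix.of_apply, Matrix.sum_apply, Matrix.smul_apply,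
    ← Nat.cast_smul_eq_nsmul ℝ, smul_eq_mul] using h.deriv

theorem mderiv_qsym_mul_psym {n : ℕ} {A : ℝ → Matrix (Fin n) (Fin n) ℝ} (hA : MSmooth A)
    (a b : ℕ) (s : ℝ) :
    mderiv (fun t => Qsym A b t * Psym A a t) s =
      Qsym A (b + 1) s * Psym A a s + Qsym A b s * Psym A (a + 1) s := by
  rw [(hA.qsym b).mderiv_mul (hA.psym a)]
  simp only [Qsym, Psym]
  noncomm_ring

theorem sum_choose_qsym_mul_psym_succ {n : ℕ} {A : ℝ → Matrix (Fin n) (Fin n) ℝ}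
    (hA : MSmooth A) (k : ℕ) (s : ℝ) :
    ∑ p ∈ antidiagonal (k + 1), (k + 1).choose p.1 • (Qsym A p.2 s * Psym A p.1 s) =
      mderiv (fun t => ∑ p ∈ antidiagonal k, k.choose p.1 • (Qsym A p.2 t * Psym A p.1 t)) s := by
  rw [mderiv_sum_smul _ _ (fun p : ℕ × ℕ => (hA.qsym p.2).mul (hA.psym p.1)),
    Finset.sum_antidiagonal_choose_succ_nsmul (fun a b => Qsym A b s * Psym A a s)]
  simp only [mderiv_qsym_mul_psym hA, smul_add, Finset.sum_add_distrib]
  congr 1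
  refine Finset.sum_congr rfl fun p hp => ?_
  rw [Nat.choose_symm_of_eq_add (Finset.HasAntidiagonal.mem_antidiagonal.1 hp).symm]

theorem sum_choose_qsym_mul_psym_eq_zero {n : ℕ} {A : ℝ → Matrix (Fin n) (Fin n) ℝ}
    (hA : MSmooth A) (k : ℕ) (s : ℝ) :
    ∑ p ∈ antidiagonal (k + 1), (k + 1).choose p.1 • (Qsym A p.2 s * Psym A p.1 s) = 0 := by
  induction k generalizing s with
  | zero =>
    rw [sum_choose_qsym_mul_psym_succ hA]
    ext i j
    simp [mderiv, Qsym, Psym]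
  | succ k ih =>
    rw [sum_choose_qsym_mul_psym_succ hA]
    ext i j
    simp only [mderiv, ih]
    simp

theorem stmt4 {n : ℕ} (A : ℝ → Matrix (Fin n) (Fin n) ℝ) (hA : MSmooth A) (k : ℕ) (hk : 1 ≤ k)
    (s : ℝ) :
    ∑ r ∈ Finset.range (k + 1), (k.choose r : ℝ) • (Qsym A (k - r) s * Psym A r s) = 0 := by
  obtain ⟨k, rfl⟩ := Nat.exists_eq_add_of_le' hk
  rw [← sum_choose_qsym_mul_psym_eq_zero hA k s, Finset.Nat.sum_antidiagonal_eq_sum_range_succ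
    fun a b => (k + 1).choose a • (Qsym A b s * Psym A a s)]
  simp only [Nat.cast_smul_eq_nsmul]
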